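/- Let {⟨α_i,α_i'⟩}_{i∈I} be a full, interior disjoint, unlinked countable collection of segment pairings on [0,L], with induced relation R and chain semi-metric d^R. Let 0 ≤ x < y ≤ L be points which do not lie in the open interior of any of the intervals α_i, α_i'. Then d^R(x,y) = 0 if and only if every pairing ⟨α_i,α_i'⟩ at least one of whose segments meets the open interval (x,y) has both of its segments contained in [x,y]. -/

import Mathlib

open Set

/-- A countable collection of segment pairings on the interval `[0, L]`:
the `i`-th pairing identifies the subinterval `[a i, b i]` with the subinterval
`[c i, d i]` (of the same positive length) in a length-preserving,
orientation-reversing way. -/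
structure SegPairings (L : ℝ) where
  ι : Type
  countable : Countable ι
  a : ι → ℝ
  b : ι → ℝ
  c : ι → ℝ
  d : ι → ℝ
  ha : ∀ i, 0 ≤ a i
  hbL : ∀ i, b i ≤ L
  hc : ∀ i, 0 ≤ c i
  hdL : ∀ i, d i ≤ L
  len_eq : ∀ i, b i - a i = d i - c i
  len_pos : ∀ i, 0 < b i - a i

namespace SegPairings

variable {L : ℝ} (P : SegPairings L)

/-- The open interiors of the segments of the pairings, indexed by `ι × Bool`. -/
def seg (p : P.ι × Bool) : Set ℝ :=
  if p.2 then Set.Ioo (P.c p.1) (P.d p.1) else Set.Ioo (P.a p.1) (P.b p.1)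

/-- The collection is interior disjoint: the open interiors of all of the
segments `α_i`, `α_i'` are pairwise disjoint. -/
def InteriorDisjoint : Prop :=
  Pairwise fun p q => Disjoint (P.seg p) (P.seg q)

/-- The collection is full: the total length of the pairings is `L`. -/
def Full : Prop := ∑' i, 2 * (P.b i - P.a i) = L

/-- `x` and `y` are paired by the `i`-th pairing (orientation-reversing
identification of `[a i, b i]` with `[c i, d i]`). -/
def PairedBy (i : P.ι) (x y : ℝ) : Prop :=
  ∃ t, 0 ≤ t ∧ t ≤ P.b i - P.a i ∧
    ((x = P.a i + t ∧ y = P.d i - t) ∨ (y = P.a i + t ∧ x = P.d i - t))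

/-- The reflexive symmetric relation induced by the collection of pairings. -/
def R (x y : ℝ) : Prop := x = y ∨ ∃ i, P.PairedBy i x y

/-- The set of lengths of `R`-chains from `x` to `y`. -/
def chainLengths (x y : ℝ) : Set ℝ :=
  {l | ∃ (k : ℕ) (p q : ℕ → ℝ), P.R x (p 0) ∧ (∀ i < k, P.R (q i) (p (i+1))) ∧
    P.R (q k) y ∧ l = ∑ i ∈ Finset.range (k+1), |p i - q i|}

/-- The chain semi-metric `d^R` induced by the collection of pairings. -/
noncomputable def dR (x y : ℝ) : ℝ := sInf (P.chainLengths x y)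

end SegPairings

/-- Two pairs of points `{x, x'}` and `{y, y'}` of `[0, L]` are unlinked: one of the
pairs is contained in the closure of a single connected component of the complement
(in `[0, L]`) of the other pair. -/
def UnlinkedPairs (x x' y y' : ℝ) : Prop :=
  (max y y' ≤ min x x' ∨ (min x x' ≤ min y y' ∧ max y y' ≤ max x x') ∨ max x x' ≤ min y y') ∨
  (max x x' ≤ min y y' ∨ (min y y' ≤ min x x' ∧ max x x' ≤ max y y') ∨ max y y' ≤ min x x')

/-- The collection of pairings is unlinked: points paired by two different pairings
always form unlinked pairs. -/
def SegPairings.Unlinked {L : ℝ} (P : SegPairings L) : Prop :=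
  ∀ i j, i ≠ j → ∀ x x' y y', P.PairedBy i x x' → P.PairedBy j y y' →
    UnlinkedPairs x x' y y'

namespace SegPairings

variable {L : ℝ} (P : SegPairings L)

variable {P} in
theorem PairedBy.symm {i : P.ι} {x y : ℝ} (h : P.PairedBy i x y) : P.PairedBy i y x := by
  obtain ⟨t, h0, h1, h⟩ := h
  exact ⟨t, h0, h1, h.symm⟩

theorem R_self (x : ℝ) : P.R x x := Or.inl rfl

/-- The pairing written from the outermost endpoints of its two segments. -/
theorem pairedBy_outer (i : P.ι) {t : ℝ} (h0 : 0 ≤ t) (h1 : t ≤ P.b i - P.a i) :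
    P.PairedBy i (min (P.a i) (P.c i) + t) (max (P.b i) (P.d i) - t) := by
  have h := P.len_eq i
  rcases le_total (P.a i) (P.c i) with hac | hac
  · rw [min_eq_left hac, max_eq_right (by linarith)]
    exact ⟨t, h0, h1, Or.inl ⟨rfl, rfl⟩⟩
  · rw [min_eq_right hac, max_eq_left (by linarith)]
    exact ⟨P.b i - P.a i - t, by linarith, by linarith, Or.inr ⟨by ring, by linarith⟩⟩

/-- Position across the strip joining the two segments of the `i`-th pairing: zero outside the
strip, the length of the segments inside, interpolated with slope one along the segments. -/
noncomputable def strip (i : P.ι) (z : ℝ) : ℝ :=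
  max 0 (min (min (z - min (P.a i) (P.c i)) (max (P.b i) (P.d i) - z)) (P.b i - P.a i))

theorem abs_strip_sub_le (i : P.ι) (p q : ℝ) : |P.strip i p - P.strip i q| ≤ |p - q| := by
  unfold strip
  refine (abs_max_sub_max_le_max _ _ _ _).trans (max_le (by simp) ?_)
  refine (abs_min_sub_min_le_max _ _ _ _).trans (max_le ?_ (by simp))
  refine (abs_min_sub_min_le_max _ _ _ _).trans (max_le (by simp) ?_)
  rw [sub_sub_sub_cancel_left, abs_sub_comm]

theorem strip_eq_of_pairedBy_self {i : P.ι} {p q : ℝ} (h : P.PairedBy i p q) :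
    P.strip i p = P.strip i q := by
  have hl := P.len_eq i
  have hs : min (P.a i) (P.c i) + max (P.b i) (P.d i) = p + q := by
    obtain ⟨t, -, -, ⟨rfl, rfl⟩ | ⟨rfl, rfl⟩⟩ := h <;>
    rcases le_total (P.a i) (P.c i) with hac | hac <;>
    first
    | rw [min_eq_left hac, max_eq_right (by linarith)]; linarith
    | rw [min_eq_right hac, max_eq_left (by linarith)]; linarith
  unfold strip
  rw [show p - min (P.a i) (P.c i) = max (P.b i) (P.d i) - q by linarith,
    show max (P.b i) (P.d i) - p = q - min (P.a i) (P.c i) by linarith,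
    min_comm (max (P.b i) (P.d i) - q)]

theorem strip_le_of_pairedBy_ne (hunl : P.Unlinked) {i j : P.ι} (hij : i ≠ j) {p q : ℝ}
    (h : P.PairedBy j p q) : P.strip i q ≤ P.strip i p := by
  by_contra! hlt
  obtain ⟨t, hpt, htq⟩ := exists_between hlt
  have ht0 : 0 < t := (le_max_left _ _).trans_lt hpt
  simp only [strip, max_lt_iff, lt_max_iff, lt_min_iff, min_lt_iff] at hpt htq
  have hq := htq.resolve_left ht0.not_gt
  have hp : p < min (P.a i) (P.c i) + t ∨ max (P.b i) (P.d i) - t < p := by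
    rcases hpt.2 with (h | h) | h
    · left; linarith
    · right; linarith
    · linarith
  have hu := hunl i j hij _ _ _ _ (P.pairedBy_outer i ht0.le hq.2.le) h
  have h1 : min (P.a i) (P.c i) + t < q := by linarith
  have h2 : q < max (P.b i) (P.d i) - t := by linarith
  generalize min (P.a i) (P.c i) + t = u at *
  generalize max (P.b i) (P.d i) - t = v at *
  simp only [UnlinkedPairs, min_eq_left (h1.trans h2).le, max_eq_right (h1.trans h2).le,
    le_min_iff, max_le_iff, min_le_iff, le_max_iff] at hu
  grind

theorem strip_eq_of_R (hunl : P.Unlinked) (i : P.ι) {p q : ℝ} (h : P.R p q) :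
    P.strip i p = P.strip i q := by
  obtain rfl | ⟨j, h⟩ := h
  · rfl
  by_cases hij : i = j
  · subst hij
    exact P.strip_eq_of_pairedBy_self h
  · exact le_antisymm (P.strip_le_of_pairedBy_ne hunl hij h.symm)
      (P.strip_le_of_pairedBy_ne hunl hij h)

theorem abs_strip_sub_le_of_mem_chainLengths (hunl : P.Unlinked) (i : P.ι) {x y l : ℝ}
    (hl : l ∈ P.chainLengths x y) : |P.strip i x - P.strip i y| ≤ l := by
  obtain ⟨k, p, q, h0, h1, h2, rfl⟩ := hl
  rw [P.strip_eq_of_R hunl i h0, ← P.strip_eq_of_R hunl i h2]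
  clear h0 h2
  induction k with
  | zero => simpa using P.abs_strip_sub_le i (p 0) (q 0)
  | succ k ih =>
    rw [Finset.sum_range_succ]
    have h3 := ih fun j hj => h1 j (by omega)
    rw [P.strip_eq_of_R hunl i (h1 k (by omega))] at h3
    exact (abs_sub_le _ _ _).trans (add_le_add h3 (P.abs_strip_sub_le i _ _))

theorem abs_sub_mem_chainLengths (x y : ℝ) : |x - y| ∈ P.chainLengths x y :=
  ⟨0, fun _ => x, fun _ => y, P.R_self x, by simp, P.R_self y, by simp⟩

theorem nonneg_of_mem_chainLengths {x y l : ℝ} (hl : l ∈ P.chainLengths x y) : 0 ≤ l := by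
  obtain ⟨k, p, q, -, -, -, rfl⟩ := hl
  positivity

theorem abs_strip_sub_le_dR (hunl : P.Unlinked) (i : P.ι) (x y : ℝ) :
    |P.strip i x - P.strip i y| ≤ P.dR x y :=
  le_csInf ⟨_, P.abs_sub_mem_chainLengths x y⟩
    fun _ hl => P.abs_strip_sub_le_of_mem_chainLengths hunl i hl

variable {P} in
theorem add_mem_chainLengths {v s w y l : ℝ} (hvs : P.R v s) (hl : l ∈ P.chainLengths w y) :
    |s - w| + l ∈ P.chainLengths v y := by
  obtain ⟨k, p, q, h0, h1, h2, rfl⟩ := hl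
  refine ⟨k + 1, fun n => n.casesOn s p, fun n => n.casesOn w q, hvs, ?_, h2, ?_⟩
  · rintro (_ | n) hn
    · exact h0
    · exact h1 n (by omega)
  · rw [Finset.sum_range_succ' _ (k + 1)]
    exact add_comm _ _

theorem two_mul_sum_le_volume (hdisj : P.InteriorDisjoint) (F : Finset P.ι) {S : Set ℝ}
    (hS : ∀ i ∈ F, Ioo (P.a i) (P.b i) ⊆ S ∧ Ioo (P.c i) (P.d i) ⊆ S) :
    ENNReal.ofReal (∑ i ∈ F, 2 * (P.b i - P.a i)) ≤ MeasureTheory.volume S := by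
  have hm : ∀ p, MeasurableSet (P.seg p) := by
    intro p
    unfold seg
    split <;> exact measurableSet_Ioo
  calc ENNReal.ofReal (∑ i ∈ F, 2 * (P.b i - P.a i))
      = ∑ p ∈ F ×ˢ (Finset.univ : Finset Bool), MeasureTheory.volume (P.seg p) := by
        rw [Finset.sum_product,
          ENNReal.ofReal_sum_of_nonneg fun i _ => by linarith [P.len_pos i]]
        refine Finset.sum_congr rfl fun i _ => ?_
        simp only [seg, Fintype.sum_bool, if_true, Bool.false_eq_true, if_false, Real.volume_Ioo]
        rw [← P.len_eq, ← ENNReal.ofReal_add (P.len_pos i).le (P.len_pos i).le, two_mul]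
    _ = MeasureTheory.volume (⋃ p ∈ F ×ˢ (Finset.univ : Finset Bool), P.seg p) :=
        (MeasureTheory.measure_biUnion_finset (fun p _ q _ hpq => hdisj hpq)
          fun p _ => hm p).symm
    _ ≤ MeasureTheory.volume S := by
        refine MeasureTheory.measure_mono (iUnion₂_subset ?_)
        rintro ⟨i, _ | _⟩ hp
        · simpa [seg] using (hS i (Finset.mem_product.1 hp).1).1
        · simpa [seg] using (hS i (Finset.mem_product.1 hp).1).2

/-- No segment of another pairing straddles the outer right endpoint of a pairing. -/
theorem le_outer_of_lt (hdisj : P.InteriorDisjoint) {i j : P.ι} (hij : j ≠ i) :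
    (P.a j < max (P.b i) (P.d i) → P.b j ≤ max (P.b i) (P.d i)) ∧
      (P.c j < max (P.b i) (P.d i) → P.d j ≤ max (P.b i) (P.d i)) := by
  have hpos := P.len_pos i
  have hlen := P.len_eq i
  have key : ∀ β γ, ∀ u v w z, P.seg (j, β) = Ioo u v → P.seg (i, γ) = Ioo w z → w < z →
      u < z → v ≤ z := by
    intro β γ u v w z h1 h2 hwz huz
    have h : Disjoint (P.seg (j, β)) (P.seg (i, γ)) := hdisj (by simp [hij])
    rw [h1, h2, Ioo_disjoint_Ioo] at h
    by_contra! hzv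
    rw [min_eq_right hzv.le] at h
    exact (max_lt huz hwz).not_ge h
  rcases le_total (P.b i) (P.d i) with h | h
  · rw [max_eq_right h]
    exact ⟨key false true _ _ _ _ rfl rfl (by linarith),
      key true true _ _ _ _ rfl rfl (by linarith)⟩
  · rw [max_eq_left h]
    exact ⟨key false false _ _ _ _ rfl rfl (by linarith),
      key true false _ _ _ _ rfl rfl (by linarith)⟩

/-- A pairing with no segment to the left of the `i`-th one, and some segment starting before the
outer right endpoint of the `i`-th one, is nested inside the `i`-th one. -/
theorem le_outer_of_min_lt (hdisj : P.InteriorDisjoint) (hunl : P.Unlinked) {i j : P.ι}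
    (hle : min (P.a i) (P.c i) ≤ min (P.a j) (P.c j))
    (hlt : min (P.a j) (P.c j) < max (P.b i) (P.d i)) :
    max (P.b j) (P.d j) ≤ max (P.b i) (P.d i) := by
  by_cases hij : j = i
  · rw [hij]
  obtain ⟨h1, h2⟩ := P.le_outer_of_lt hdisj hij
  have hu := hunl i j (Ne.symm hij) _ _ _ _ (P.pairedBy_outer i le_rfl (P.len_pos i).le)
    ⟨(P.b j - P.a j) / 2, by linarith [P.len_pos j], by linarith [P.len_pos j],
      Or.inl ⟨rfl, rfl⟩⟩
  have hpos := P.len_pos j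
  have hlen := P.len_eq j
  rw [add_zero, sub_zero] at hu
  rw [le_min_iff] at hle
  generalize min (P.a i) (P.c i) = s at *
  generalize max (P.b i) (P.d i) = e at *
  have hse : s < e := by
    rcases min_lt_iff.1 hlt with h | h <;> linarith
  simp only [UnlinkedPairs, min_eq_left hse.le, max_eq_right hse.le,
    le_min_iff, max_le_iff, min_le_iff, le_max_iff] at hu
  rw [max_le_iff]
  rcases min_lt_iff.1 hlt with h | h
  · have h3 := h1 h
    refine ⟨h3, h2 ?_⟩
    by_contra! hc
    rcases hu with (hu | hu | hu) | (hu | hu | hu) <;> grind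
  · have h3 := h2 h
    refine ⟨h1 ?_, h3⟩
    by_contra! hc
    rcases hu with (hu | hu | hu) | (hu | hu | hu) <;> grind

theorem exists_chain_le (hdisj : P.InteriorDisjoint) (hunl : P.Unlinked) (F : Finset P.ι)
    (u y : ℝ) (huy : u ≤ y)
    (hF : ∀ i ∈ F, u ≤ min (P.a i) (P.c i) ∧ max (P.b i) (P.d i) ≤ y) :
    ∃ l ∈ P.chainLengths u y, l ≤ y - u - ∑ i ∈ F, 2 * (P.b i - P.a i) := by
  induction F using Finset.strongInduction generalizing u with
  | H F ih =>
  obtain rfl | hne := F.eq_empty_or_nonempty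
  · exact ⟨_, P.abs_sub_mem_chainLengths u y, by
      rw [abs_sub_comm, abs_of_nonneg (by linarith)]; simp⟩
  obtain ⟨i, hiF, hmin⟩ := F.exists_min_image (fun i => min (P.a i) (P.c i)) hne
  have hse : min (P.a i) (P.c i) < max (P.b i) (P.d i) :=
    (min_le_left _ _).trans_lt
      ((sub_pos.1 (P.len_pos i)).trans_le (le_max_left (P.b i) (P.d i)))
  have hR : P.R (min (P.a i) (P.c i)) (max (P.b i) (P.d i)) := by
    exact Or.inr ⟨i, by simpa using P.pairedBy_outer i le_rfl (P.len_pos i).le⟩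
  set s := min (P.a i) (P.c i)
  set e := max (P.b i) (P.d i)
  obtain ⟨l, hl, hle⟩ := ih (F.filter fun j => e ≤ min (P.a j) (P.c j))
    (Finset.filter_ssubset.2 ⟨i, hiF, hse.not_ge⟩) e (hF i hiF).2 fun j hj =>
      ⟨(Finset.mem_filter.1 hj).2, (hF j (Finset.mem_filter.1 hj).1).2⟩
  refine ⟨_, add_mem_chainLengths (P.R_self u) (add_mem_chainLengths hR hl), ?_⟩
  have hvol := P.two_mul_sum_le_volume hdisj
    (F.filter fun j => ¬ e ≤ min (P.a j) (P.c j)) (S := Ioo s e) (fun j hj => by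
      obtain ⟨hjF, hj⟩ := Finset.mem_filter.1 hj
      have h1 := P.le_outer_of_min_lt hdisj hunl (hmin j hjF) (not_le.1 hj)
      have h2 := hmin j hjF
      exact ⟨Ioo_subset_Ioo (h2.trans (min_le_left _ _)) ((le_max_left _ _).trans h1),
        Ioo_subset_Ioo (h2.trans (min_le_right _ _)) ((le_max_right _ _).trans h1)⟩)
  rw [Real.volume_Ioo, ENNReal.ofReal_le_ofReal_iff (by linarith)] at hvol
  have hsplit := Finset.sum_filter_add_sum_filter_not F (fun j => e ≤ min (P.a j) (P.c j))
    fun j => 2 * (P.b j - P.a j)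
  have hus : u ≤ s := (hF i hiF).1
  rw [abs_sub_comm, abs_of_nonneg (by linarith), sub_self, abs_zero]
  linarith

theorem dR_eq_zero (hL : 0 < L) (hfull : P.Full) (hdisj : P.InteriorDisjoint)
    (hunl : P.Unlinked) {x y : ℝ} (hx : 0 ≤ x) (hxy : x < y) (hyL : y ≤ L)
    (h : ∀ i, ((Icc (P.a i) (P.b i) ∩ Ioo x y).Nonempty ∨
        (Icc (P.c i) (P.d i) ∩ Ioo x y).Nonempty) →
      Icc (P.a i) (P.b i) ⊆ Icc x y ∧ Icc (P.c i) (P.d i) ⊆ Icc x y) :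
    P.dR x y = 0 := by
  classical
  have hsum : HasSum (fun i => 2 * (P.b i - P.a i)) L := by
    have hs : Summable fun i => 2 * (P.b i - P.a i) := by
      by_contra hs
      exact hL.ne ((tsum_eq_zero_of_not_summable hs).symm.trans hfull)
    exact hs.hasSum_iff.2 hfull
  have hbdd : BddBelow (P.chainLengths x y) := ⟨0, fun _ => P.nonneg_of_mem_chainLengths⟩
  refine le_antisymm (le_of_forall_pos_lt_add fun ε hε => ?_)
    (Real.sInf_nonneg fun _ => P.nonneg_of_mem_chainLengths)
  obtain ⟨F, hF⟩ := (hsum.eventually (lt_mem_nhds (sub_lt_self L hε))).exists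
  set M : P.ι → Prop := fun i => (Icc (P.a i) (P.b i) ∩ Ioo x y).Nonempty ∨
        (Icc (P.c i) (P.d i) ∩ Ioo x y).Nonempty
  obtain ⟨l, hl, hle⟩ := P.exists_chain_le hdisj hunl (F.filter M) x y hxy.le fun i hi => by
    obtain ⟨h1, h2⟩ := h i (Finset.mem_filter.1 hi).2
    have hp := P.len_pos i
    have hlen := P.len_eq i
    rw [Icc_subset_Icc_iff (by linarith)] at h1 h2
    exact ⟨le_min h1.1 h2.1, max_le h1.2 h2.2⟩
  have hvol := (P.two_mul_sum_le_volume hdisj (F.filter fun i => ¬ M i)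
    (S := Icc 0 x ∪ Icc y L) (fun i hi => by
      have hM := (Finset.mem_filter.1 hi).2
      have h0 := P.ha i
      have h1 := P.hbL i
      have h2 := P.hc i
      have h3 := P.hdL i
      refine ⟨fun z hz => ?_, fun z hz => ?_⟩
      · by_contra hz'
        refine hM (Or.inl ⟨z, ⟨hz.1.le, hz.2.le⟩, ?_⟩)
        simp only [mem_union, mem_Icc, mem_Ioo] at *
        grind
      · by_contra hz'
        refine hM (Or.inr ⟨z, ⟨hz.1.le, hz.2.le⟩, ?_⟩)
        simp only [mem_union, mem_Icc, mem_Ioo] at *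
        grind)).trans (MeasureTheory.measure_union_le _ _)
  rw [Real.volume_Icc, Real.volume_Icc, ← ENNReal.ofReal_add (by linarith) (by linarith),
    ENNReal.ofReal_le_ofReal_iff (by linarith)] at hvol
  have hsplit := Finset.sum_filter_add_sum_filter_not F M fun j => 2 * (P.b j - P.a j)
  have : P.dR x y ≤ l := csInf_le hbdd hl
  linarith

end SegPairings

/-- An interval whose interior avoids `x < y` and which meets `(x, y)` lies in `[x, y]`. -/
theorem Icc_subset_Icc_of_inter_Ioo_nonempty {p q x y : ℝ} (hx : x ∉ Ioo p q) (hy : y ∉ Ioo p q)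
    (h : (Icc p q ∩ Ioo x y).Nonempty) : Icc p q ⊆ Icc x y := by
  obtain ⟨z, hz, hzxy⟩ := h
  simp only [mem_Icc, mem_Ioo] at *
  exact Icc_subset_Icc (by grind) (by grind)

/-- An interval whose interior avoids `x < y` and which is not contained in `[x, y]` lies on one
side of `[x, y]`. -/
theorem le_or_le_of_not_Icc_subset_Icc {p q x y : ℝ} (hx : x ∉ Ioo p q) (hy : y ∉ Ioo p q)
    (h : ¬ Icc p q ⊆ Icc x y) : q ≤ x ∨ y ≤ p := by
  by_contra! h'
  refine h (Icc_subset_Icc ?_ ?_) <;> simp only [mem_Ioo] at * <;> grind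

namespace SegPairings

variable {L : ℝ} (P : SegPairings L)

/-- If `[x, y]` contains one segment of a pairing and the other segment lies on one side of
`[x, y]`, then the pairing separates `x` from `y`. -/
theorem abs_strip_sub_eq {i : P.ι} {x y : ℝ}
    (h : (x ≤ P.a i ∧ P.b i ≤ y ∧ (P.d i ≤ x ∨ y ≤ P.c i)) ∨
      (x ≤ P.c i ∧ P.d i ≤ y ∧ (P.b i ≤ x ∨ y ≤ P.a i))) :
    |P.strip i x - P.strip i y| = P.b i - P.a i := by
  have hpos := P.len_pos i
  have hlen := P.len_eq i
  unfold strip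
  rcases h with ⟨h1, h2, h | h⟩ | ⟨h1, h2, h | h⟩
  · rw [min_eq_right (by linarith : P.c i ≤ P.a i), max_eq_left (by linarith : P.d i ≤ P.b i)]
    rw [min_eq_right (le_min (by linarith) (by linarith)), max_eq_right hpos.le, max_eq_left
      (min_le_of_left_le (min_le_of_right_le (by linarith))), sub_zero, abs_of_pos hpos]
  · rw [min_eq_left (by linarith : P.a i ≤ P.c i), max_eq_right (by linarith : P.b i ≤ P.d i)]
    rw [min_eq_right (le_min (by linarith) (by linarith) :
        P.b i - P.a i ≤ min (y - P.a i) (P.d i - y)), max_eq_right hpos.le, max_eq_left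
      (min_le_of_left_le (min_le_of_left_le (by linarith))), zero_sub, abs_neg, abs_of_pos hpos]
  · rw [min_eq_left (by linarith : P.a i ≤ P.c i), max_eq_right (by linarith : P.b i ≤ P.d i)]
    rw [min_eq_right (le_min (by linarith) (by linarith)), max_eq_right hpos.le, max_eq_left
      (min_le_of_left_le (min_le_of_right_le (by linarith))), sub_zero, abs_of_pos hpos]
  · rw [min_eq_right (by linarith : P.c i ≤ P.a i), max_eq_left (by linarith : P.d i ≤ P.b i)]
    rw [min_eq_right (le_min (by linarith) (by linarith) :
        P.b i - P.a i ≤ min (y - P.c i) (P.b i - y)), max_eq_right hpos.le, max_eq_left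
      (min_le_of_left_le (min_le_of_left_le (by linarith))), zero_sub, abs_neg, abs_of_pos hpos]

end SegPairings

/-- For a full, interior disjoint, unlinked collection of segment pairings on `[0,L]`
and points `x < y` of `[0,L]` not lying in the open interior of any paired segment:
`d^R(x,y) = 0` if and only if every pairing at least one of whose segments meets the
open interval `(x,y)` has both of its segments contained in `[x,y]`. -/
theorem stmt4 {L : ℝ} (hL : 0 < L) (P : SegPairings L)
    (hfull : P.Full) (hdisj : P.InteriorDisjoint) (hunl : P.Unlinked)
    (x y : ℝ) (hx : 0 ≤ x) (hxy : x < y) (hyL : y ≤ L)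
    (hxint : ∀ i, x ∉ Set.Ioo (P.a i) (P.b i) ∧ x ∉ Set.Ioo (P.c i) (P.d i))
    (hyint : ∀ i, y ∉ Set.Ioo (P.a i) (P.b i) ∧ y ∉ Set.Ioo (P.c i) (P.d i)) :
    P.dR x y = 0 ↔
      ∀ i, ((Set.Icc (P.a i) (P.b i) ∩ Set.Ioo x y).Nonempty ∨
            (Set.Icc (P.c i) (P.d i) ∩ Set.Ioo x y).Nonempty) →
        Set.Icc (P.a i) (P.b i) ⊆ Set.Icc x y ∧ Set.Icc (P.c i) (P.d i) ⊆ Set.Icc x y := by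
  refine ⟨fun hd i hmeet => ?_, P.dR_eq_zero hL hfull hdisj hunl hx hxy hyL⟩
  have hpos := P.len_pos i
  have hlen := P.len_eq i
  have hnot : ¬ ((x ≤ P.a i ∧ P.b i ≤ y ∧ (P.d i ≤ x ∨ y ≤ P.c i)) ∨
      (x ≤ P.c i ∧ P.d i ≤ y ∧ (P.b i ≤ x ∨ y ≤ P.a i))) := fun h => by
    have := P.abs_strip_sub_le_dR hunl i x y
    rw [P.abs_strip_sub_eq h, hd] at this
    linarith
  rcases hmeet with h | h
  · have h1 := Icc_subset_Icc_of_inter_Ioo_nonempty (hxint i).1 (hyint i).1 h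
    refine ⟨h1, ?_⟩
    by_contra h2
    have h3 := (Icc_subset_Icc_iff (by linarith)).1 h1
    exact hnot (Or.inl ⟨h3.1, h3.2,
      le_or_le_of_not_Icc_subset_Icc (hxint i).2 (hyint i).2 h2⟩)
  · have h1 := Icc_subset_Icc_of_inter_Ioo_nonempty (hxint i).2 (hyint i).2 h
    refine ⟨?_, h1⟩
    by_contra h2
    have h3 := (Icc_subset_Icc_iff (by linarith)).1 h1
    exact hnot (Or.inr ⟨h3.1, h3.2,
      le_or_le_of_not_Icc_subset_Icc (hxint i).1 (hyint i).1 h2⟩)
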